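/- Let K = ⋃_{h=1}^n [V_h, V_{h+1}] (V_{n+1} = V₁, n ≥ 3) be a polygonal knot in ℝ³ and let Π be a plane in ℝ³, with π : ℝ³ → Π the orthogonal projection. Assume: (i) every line orthogonal to Π intersects at most two of the edges [V_h, V_{h+1}] of K; (ii) V is a vertex of K such that there is a closed half-plane H of Π with π(K) ⊆ H and π(K) ∩ ∂H = {π(V)}, and π⁻¹(π(V)) ∩ K = {V}. Let Σ be a plane in ℝ³ whose direction contains the vector (0,0,1) (Σ is perpendicular to the xy-plane), let P ∈ Σ, and let ε > 0, δ > 0. Then there exists an invertible affine transformation T : ℝ³ → ℝ³ such that: (a) T(Π) is parallel to the xy-plane; (b) T(V) = P and T(K) is contained in the open ball of radius ε centered at P; (c) T(K) ∩ Σ = {P}; (d) every line in ℝ³ that intersects at least three of the segments [T(V_h), T(V_{h+1})] makes an angle smaller than δ with the xy-plane. -/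

import Mathlib

noncomputable section

/-- Euclidean 3-space. -/
abbrev E3 : Type := EuclideanSpace ℝ (Fin 3)

open scoped RealInnerProductSpace

/-- The unit directions of lines meeting three members, with distinct indices, of the family `S`. -/
def trisecantDirections {ι E : Type*} [NormedAddCommGroup E] [InnerProductSpace ℝ E]
    (S : ι → Set E) : Set E :=
  {v | ‖v‖ = 1 ∧ ∃ i j k, i ≠ j ∧ i ≠ k ∧ j ≠ k ∧ ∃ p ∈ S i, ∃ q ∈ S j, ∃ r ∈ S k,
    q - p = ⟪v, q - p⟫ • v ∧ r - p = ⟪v, r - p⟫ • v}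

theorem isCompact_trisecantDirections {ι E : Type*} [Finite ι] [NormedAddCommGroup E]
    [InnerProductSpace ℝ E] [FiniteDimensional ℝ E] {S : ι → Set E}
    (hS : ∀ i, IsCompact (S i)) : IsCompact (trisecantDirections S) := by
  have : ProperSpace E := FiniteDimensional.proper ℝ E
  let C (i j k : ι) : Set (E × E × E × E) :=
    (Metric.sphere 0 1 ×ˢ S i ×ˢ S j ×ˢ S k) ∩
      {x | x.2.2.1 - x.2.1 = ⟪x.1, x.2.2.1 - x.2.1⟫ • x.1 ∧
        x.2.2.2 - x.2.1 = ⟪x.1, x.2.2.2 - x.2.1⟫ • x.1}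
  have hC (i j k : ι) : IsCompact (C i j k) := by
    refine ((isCompact_sphere _ _).prod ((hS i).prod ((hS j).prod (hS k)))).inter_right ?_
    exact (isClosed_eq (by fun_prop) (by fun_prop)).inter
      (isClosed_eq (by fun_prop) (by fun_prop))
  have hA : trisecantDirections S =
      ⋃ t : {t : ι × ι × ι // t.1 ≠ t.2.1 ∧ t.1 ≠ t.2.2 ∧ t.2.1 ≠ t.2.2},
        Prod.fst '' C t.1.1 t.1.2.1 t.1.2.2 := by
    ext v
    simp only [trisecantDirections, Set.mem_ofPred_eq, Set.mem_iUnion, Set.mem_image]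
    constructor
    · rintro ⟨hv, i, j, k, hij, hik, hjk, p, hp, q, hq, r, hr, h⟩
      exact ⟨⟨(i, j, k), hij, hik, hjk⟩, (v, p, q, r),
        ⟨⟨by simpa using hv, hp, hq, hr⟩, h⟩, rfl⟩
    · rintro ⟨⟨⟨i, j, k⟩, hij, hik, hjk⟩, ⟨v, p, q, r⟩, ⟨⟨hv, hp, hq, hr⟩, h⟩, rfl⟩
      exact ⟨by simpa using hv, i, j, k, hij, hik, hjk, p, hp, q, hq, r, hr, h⟩
  rw [hA]
  exact isCompact_iUnion fun t => (hC _ _ _).image continuous_fst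

/-- If no line in the direction of the unit vector `w` meets three members of a finite family of
compact sets, then the trisecant directions stay away from `w`. -/
theorem exists_pos_le_one_sub_inner_sq {ι E : Type*} [Finite ι] [NormedAddCommGroup E]
    [InnerProductSpace ℝ E] [FiniteDimensional ℝ E] {S : ι → Set E}
    (hS : ∀ i, IsCompact (S i)) {w : E} (hw : ‖w‖ = 1)
    (h : ∀ i j k, i ≠ j → i ≠ k → j ≠ k → ∀ p ∈ S i, ∀ q ∈ S j, ∀ r ∈ S k, ∀ s t : ℝ,
      q - p = s • w → r - p = t • w → False) :
    ∃ c > 0, ∀ v ∈ trisecantDirections S, c ≤ 1 - ⟪w, v⟫ ^ 2 := by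
  rcases (trisecantDirections S).eq_empty_or_nonempty with he | hne
  · exact ⟨1, one_pos, by simp [he]⟩
  obtain ⟨v, hv, hmin⟩ := (isCompact_trisecantDirections hS).exists_isMinOn hne
    (f := fun v => 1 - ⟪w, v⟫ ^ 2) (by fun_prop)
  refine ⟨_, ?_, fun u hu => hmin hu⟩
  obtain ⟨hv1, i, j, k, hij, hik, hjk, p, hp, q, hq, r, hr, hqp, hrp⟩ := hv
  have hle : |⟪w, v⟫| ≤ 1 := by simpa [hw, hv1] using abs_real_inner_le_norm w v
  by_contra hcon
  have hone : |⟪w, v⟫| = 1 := by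
    have : ⟪w, v⟫ ^ 2 = |⟪w, v⟫| ^ 2 := (sq_abs _).symm
    nlinarith [abs_nonneg ⟪w, v⟫]
  have hvw : v = ⟪w, v⟫ • w := by
    have h0 : ‖v - ⟪w, v⟫ • w‖ ^ 2 = 0 := by
      have hsq : ⟪w, v⟫ ^ 2 = 1 := by rw [← sq_abs, hone, one_pow]
      rw [norm_sub_sq_real, inner_smul_right, real_inner_comm w v, norm_smul, hw, hv1,
        Real.norm_eq_abs, hone]
      nlinarith
    exact sub_eq_zero.1 (norm_eq_zero.1 (pow_eq_zero_iff two_ne_zero |>.1 h0))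
  refine h i j k hij hik hjk p hp q hq r hr (⟪v, q - p⟫ * ⟪w, v⟫) (⟪v, r - p⟫ * ⟪w, v⟫) ?_ ?_
  · rw [mul_smul, ← hvw]; exact hqp
  · rw [mul_smul, ← hvw]; exact hrp

theorem exists_norm_eq_one_mem_orthogonal {E : Type*} [NormedAddCommGroup E]
    [InnerProductSpace ℝ E] [FiniteDimensional ℝ E] {D : Submodule ℝ E}
    (hD : Module.finrank ℝ D < Module.finrank ℝ E) : ∃ w ∈ Dᗮ, ‖w‖ = 1 := by
  have hne : Dᗮ ≠ ⊥ := by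
    rw [Ne, Submodule.orthogonal_eq_bot_iff]
    rintro rfl
    simp at hD
  obtain ⟨x, hx, hx0⟩ := Submodule.exists_mem_ne_zero_of_ne_bot hne
  exact ⟨‖x‖⁻¹ • x, Submodule.smul_mem _ _ hx, norm_smul_inv_norm (𝕜 := ℝ) hx0⟩

theorem exists_orthonormalBasis_fin_three {E : Type*} [NormedAddCommGroup E]
    [InnerProductSpace ℝ E] [FiniteDimensional ℝ E] (hE : Module.finrank ℝ E = 3) {x y : E}
    (hx : ‖x‖ = 1) (hy : ‖y‖ = 1) (hxy : ⟪x, y⟫ = 0) :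
    ∃ b : OrthonormalBasis (Fin 3) ℝ E, b 0 = x ∧ b 2 = y := by
  have hv : Orthonormal ℝ (({0, 2} : Set (Fin 3)).domRestrict ![x, 0, y]) := by
    rw [orthonormal_iff_ite]
    rintro ⟨i, hi⟩ ⟨j, hj⟩
    have hyx : ⟪y, x⟫ = 0 := by rw [real_inner_comm, hxy]
    obtain rfl | rfl : i = 0 ∨ i = 2 := by simpa using hi
    all_goals
      obtain rfl | rfl : j = 0 ∨ j = 2 := by simpa using hj
      all_goals simp [Set.domRestrict, hx, hy, hxy, hyx]
  obtain ⟨b, hb⟩ := hv.exists_orthonormalBasis_extension_of_card_eq (by simpa using hE)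
  exact ⟨b, by simpa using hb 0 (by simp), by simpa using hb 2 (by simp)⟩

/-- The linear automorphism sending `b i` to `a i • c i`. -/
theorem exists_linearEquiv_diagonal {ι E : Type*} [Fintype ι] [NormedAddCommGroup E]
    [InnerProductSpace ℝ E] (b c : OrthonormalBasis ι ℝ E) {a : ι → ℝ} (ha : ∀ i, a i ≠ 0) :
    ∃ M : E ≃ₗ[ℝ] E, ∀ i x, ⟪c i, M x⟫ = a i * ⟪b i, x⟫ := by
  classical
  refine ⟨b.toBasis.equiv (c.toBasis.isUnitSMul fun i => (ha i).isUnit) (Equiv.refl _),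
    fun i x => ?_⟩
  conv_lhs => rw [← b.sum_repr x]
  have hM (j : ι) : b.toBasis.equiv (c.toBasis.isUnitSMul fun i => (ha i).isUnit)
      (Equiv.refl _) (b j) = a j • c j := by
    rw [← b.coe_toBasis, Module.Basis.equiv_apply]
    simp [Module.Basis.isUnitSMul_apply]
  simp only [map_sum, map_smul, hM, inner_sum, inner_smul_right,
    orthonormal_iff_ite.1 c.orthonormal, b.repr_apply_apply]
  simp [mul_comm]

/-- Lemma 2 of the paper (`lem:smallK`).

`K = ⋃ h [V h, V (h+1)]` is a polygonal knot (vertices distinct, homeomorphic to a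
circle), `Pl` is a plane, `pr` is the orthogonal projection onto `Pl`;
(i) every line orthogonal to `Pl` (i.e. every fiber of `pr`) meets at most two edges;
(ii) `V i₀` is a vertex such that some closed half-plane `{f ≤ f (pr (V i₀))}` of `Pl`
contains `pr '' K` and meets it along its boundary line only in `pr (V i₀)`, and the
fiber of `pr` over `pr (V i₀)` meets `K` only in `V i₀`.
Given a plane `Sg` perpendicular to the xy-plane, `P ∈ Sg` and `ε, δ > 0`, there is an
invertible affine transformation `T` with:
(a) `T(Pl)` parallel to the xy-plane; (b) `T (V i₀) = P` and `T(K)` inside the open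
ε-ball about `P`; (c) `T(K) ∩ Sg = {P}`; (d) every line meeting at least three of the
edges of `T(K)` makes an angle `arcsin (|v 2| / ‖v‖) < δ` with the xy-plane. -/
theorem smallK
    (n : ℕ) [NeZero n] (hn : 3 ≤ n) (V : Fin n → E3) (hVinj : Function.Injective V)
    (K : Set E3) (hK : K = ⋃ h : Fin n, segment ℝ (V h) (V (h + 1)))
    (hknot : Nonempty (K ≃ₜ Metric.sphere (0 : EuclideanSpace ℝ (Fin 2)) 1))
    (Pl : AffineSubspace ℝ E3) (hPl : Module.finrank ℝ Pl.direction = 2)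
    (pr : E3 → E3) (hpr : ∀ x : E3, pr x ∈ Pl ∧ x - pr x ∈ Pl.directionᗮ)
    (hi : ∀ c : E3, c ∈ Pl →
      {h : Fin n | ∃ y ∈ segment ℝ (V h) (V (h + 1)), pr y = c}.ncard ≤ 2)
    (i₀ : Fin n)
    (f : E3 →ᵃ[ℝ] ℝ) (hfne : ∃ y₁ ∈ Pl, ∃ y₂ ∈ Pl, f y₁ ≠ f y₂)
    (hhalf : ∀ x ∈ K, f (pr x) ≤ f (pr (V i₀)))
    (hbd : ∀ x ∈ K, f (pr x) = f (pr (V i₀)) → pr x = pr (V i₀))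
    (hfiber : ∀ x ∈ K, pr x = pr (V i₀) → x = V i₀)
    (Sg : AffineSubspace ℝ E3) (hSg : Module.finrank ℝ Sg.direction = 2)
    (hSgz : (EuclideanSpace.single 2 1 : E3) ∈ Sg.direction)
    (P : E3) (hP : P ∈ Sg) (ε δ : ℝ) (hε : 0 < ε) (hδ : 0 < δ) :
    ∃ T : E3 ≃ᵃ[ℝ] E3,
      (Pl.map T.toAffineMap).direction =
        Submodule.span ℝ {(EuclideanSpace.single 0 1 : E3),
          (EuclideanSpace.single 1 1 : E3)} ∧
      T (V i₀) = P ∧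
      (⇑T '' K) ⊆ Metric.ball P ε ∧
      (⇑T '' K) ∩ (Sg : Set E3) = {P} ∧
      (∀ a v : E3, v ≠ 0 →
        3 ≤ {h : Fin n | ({x : E3 | ∃ t : ℝ, x = a + t • v} ∩
              segment ℝ (T (V h)) (T (V (h + 1)))).Nonempty}.ncard →
        Real.arcsin (|v 2| / ‖v‖) < δ) := by
  have hE : Module.finrank ℝ E3 = 3 := by simp
  set D := Pl.direction with hD
  obtain ⟨w, hwD, hw⟩ := exists_norm_eq_one_mem_orthogonal (D := D) (by omega)
  obtain ⟨m, hmS, hm⟩ := exists_norm_eq_one_mem_orthogonal (D := Sg.direction) (by omega)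
  -- the restriction of `f` to the plane is represented by the vector `q`
  obtain ⟨q, hq⟩ : ∃ q : D, ∀ d : D, ⟪(q : E3), (d : E3)⟫ = f.linear d := by
    refine ⟨(InnerProductSpace.toDual ℝ D).symm
      (LinearMap.toContinuousLinearMap (f.linear.domRestrict D)), fun d => ?_⟩
    rw [← Submodule.coe_inner, InnerProductSpace.toDual_symm_apply]
    rfl
  have hq0 : (q : E3) ≠ 0 := by
    obtain ⟨y₁, h₁, y₂, h₂, hne⟩ := hfne
    intro h0
    have := hq ⟨y₁ -ᵥ y₂, AffineSubspace.vsub_mem_direction h₁ h₂⟩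
    rw [h0, inner_zero_left, f.linearMap_vsub] at this
    exact hne (sub_eq_zero.1 this.symm)
  have hpos : 0 < ‖(q : E3)‖ := norm_pos_iff.2 hq0
  have hfpr (x y : E3) : ⟪(q : E3), x - y⟫ = f (pr x) - f (pr y) := by
    have h1 := hq ⟨pr x -ᵥ pr y, AffineSubspace.vsub_mem_direction (hpr x).1 (hpr y).1⟩
    rw [f.linearMap_vsub] at h1
    have h2 : ⟪(q : E3), (x - pr x) - (y - pr y)⟫ = 0 :=
      Submodule.inner_right_of_mem_orthogonal q.2 (Submodule.sub_mem _ (hpr x).2 (hpr y).2)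
    have h3 : x - y = (pr x - pr y) + ((x - pr x) - (y - pr y)) := by abel
    rw [h3, inner_add_right, h2, add_zero]
    exact h1
  have hpreq (x y : E3) (h : x - y ∈ Dᗮ) : pr x = pr y := by
    have h1 : pr x - pr y ∈ D := AffineSubspace.vsub_mem_direction (hpr x).1 (hpr y).1
    have h2 : pr x - pr y ∈ Dᗮ := by
      have h3 : pr x - pr y = (x - y) - ((x - pr x) - (y - pr y)) := by abel
      rw [h3]
      exact Submodule.sub_mem _ h (Submodule.sub_mem _ (hpr x).2 (hpr y).2)
    exact sub_eq_zero.1 (inner_self_eq_zero (𝕜 := ℝ).1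
      (Submodule.inner_right_of_mem_orthogonal h1 h2))
  obtain ⟨b, hb0, hb2⟩ := exists_orthonormalBasis_fin_three hE
    (x := ‖(q : E3)‖⁻¹ • (q : E3)) (y := w) (norm_smul_inv_norm (𝕜 := ℝ) hq0) hw
    (Submodule.inner_right_of_mem_orthogonal (Submodule.smul_mem _ _ q.2) hwD)
  obtain ⟨c, hc0, hc2⟩ := exists_orthonormalBasis_fin_three hE
    (x := m) (y := EuclideanSpace.single 2 1) hm (by simp)
    (Submodule.inner_left_of_mem_orthogonal hSgz hmS)
  let S (h : Fin n) : Set E3 := segment ℝ (V h) (V (h + 1))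
  have hS (h : Fin n) : IsCompact (S h) := by
    simp only [S, segment_eq_image_lineMap]
    exact isCompact_Icc.image AffineMap.lineMap_continuous
  have hKc : IsCompact K := hK ▸ isCompact_iUnion hS
  have hV0 : V i₀ ∈ K := hK ▸ Set.mem_iUnion.2 ⟨i₀, left_mem_segment ℝ _ _⟩
  obtain ⟨κ, hκ, hκS⟩ := exists_pos_le_one_sub_inner_sq hS hw (by
    intro i j k hij hik hjk p hp r hr u hu s t hs ht
    have hle := hi (pr p) (hpr p).1
    have hr' : pr r = pr p := hpreq _ _ (hs ▸ Submodule.smul_mem _ _ hwD)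
    have hu' : pr u = pr p := hpreq _ _ (ht ▸ Submodule.smul_mem _ _ hwD)
    exact hle.not_gt ((Set.two_lt_ncard_iff (Set.toFinite _)).2
      ⟨i, j, k, ⟨p, hp, rfl⟩, ⟨r, hr, hr'⟩, ⟨u, hu, hu'⟩, hij, hik, hjk⟩))
  obtain ⟨R, hR, hKR⟩ : ∃ R > 0, ∀ x ∈ K, ‖x - V i₀‖ ≤ R := by
    obtain ⟨R, hR⟩ := hKc.isBounded.subset_closedBall (V i₀)
    exact ⟨max R 1, by positivity, fun x hx =>
      (mem_closedBall_iff_norm.1 (hR hx)).trans (le_max_left _ _)⟩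
  obtain ⟨η, hη, harcsin⟩ : ∃ η > 0, ∀ y : ℝ, 0 ≤ y → y < η → Real.arcsin y < δ := by
    have hev := (Real.continuous_arcsin.tendsto 0).eventually_lt_const (by simpa using hδ)
    obtain ⟨η, hη, h⟩ := Metric.eventually_nhds_iff.1 hev
    exact ⟨η, hη, fun y hy hyη => h (by rwa [dist_zero_right, Real.norm_of_nonneg hy])⟩
  -- the horizontal scale `l` and the vertical compression `s`
  obtain ⟨l, hl, hlR⟩ : ∃ l > 0, l * R < ε :=
    ⟨ε / (2 * R), by positivity, by field_simp; linarith⟩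
  obtain ⟨s, hs, hs1, hsη⟩ : ∃ s > 0, s ≤ 1 ∧ s ^ 2 < η ^ 2 * κ := by
    have hpos : 0 < η ^ 2 * κ := by positivity
    refine ⟨min 1 (η ^ 2 * κ / 2), by positivity, min_le_left _ _, ?_⟩
    have h1 := min_le_left 1 (η ^ 2 * κ / 2)
    have h2 := min_le_right 1 (η ^ 2 * κ / 2)
    have h3 : 0 < min 1 (η ^ 2 * κ / 2) := by positivity
    nlinarith
  obtain ⟨M, hM⟩ := exists_linearEquiv_diagonal b c (a := ![l, l, l * s]) (by
    intro i
    fin_cases i <;> simp [hl.ne', hs.ne'])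
  have hM0 (x : E3) : ⟪m, M x⟫ = l * ⟪b 0, x⟫ := by simpa [hc0] using hM 0 x
  have hM2 (x : E3) : (M x) 2 = l * s * ⟪w, x⟫ := by
    simpa [hc2, hb2, EuclideanSpace.inner_single_left] using hM 2 x
  have hnorm (x : E3) : ‖x‖ ^ 2 = ⟪b 0, x⟫ ^ 2 + ⟪b 1, x⟫ ^ 2 + ⟪w, x⟫ ^ 2 := by
    rw [← b.sum_sq_norm_inner_right x, Fin.sum_univ_three, hb2]
    simp
  have hMnorm (x : E3) : ‖M x‖ ^ 2 = l ^ 2 * (‖x‖ ^ 2 - (1 - s ^ 2) * ⟪w, x⟫ ^ 2) := by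
    rw [← c.sum_sq_norm_inner_right, Fin.sum_univ_three, hnorm x]
    simp only [hM, hb2, Real.norm_eq_abs, sq_abs]
    simp
    ring
  have hMle (x : E3) : ‖M x‖ ≤ l * ‖x‖ := by
    refine pow_le_pow_iff_left₀ (norm_nonneg _) (by positivity) two_ne_zero |>.1 ?_
    rw [hMnorm, mul_pow]
    have : 0 ≤ (1 - s ^ 2) * ⟪w, x⟫ ^ 2 := mul_nonneg (by nlinarith) (sq_nonneg _)
    gcongr
    linarith
  let T : E3 ≃ᵃ[ℝ] E3 := (AffineEquiv.vaddConst ℝ (V i₀)).symm.trans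
    (M.toAffineEquiv.trans (AffineEquiv.vaddConst ℝ P))
  have hT (x : E3) : T x = M (x - V i₀) + P := rfl
  have hTlin : T.toAffineMap.linear = (M : E3 →ₗ[ℝ] E3) := by
    ext x : 1
    simp only [T, AffineEquiv.linear_toAffineMap]
    rfl
  have hTV : T (V i₀) = P := by simp [hT]
  refine ⟨T, ?_, hTV, ?_, ?_, ?_⟩
  · rw [AffineSubspace.map_direction, hTlin, ← hD]
    refine Submodule.eq_of_le_of_finrank_le ?_ ?_
    · rintro _ ⟨x, hx, rfl⟩
      have h2 : (M x) 2 = 0 := by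
        rw [hM2, Submodule.inner_left_of_mem_orthogonal hx hwD, mul_zero]
      rw [Submodule.mem_span_pair]
      refine ⟨M x 0, M x 1, ?_⟩
      ext i
      fin_cases i <;> simp [h2]
    · rw [LinearEquiv.finrank_map_eq, hPl]
      exact (finrank_span_le_card _).trans (by
        rw [← Set.ncard_eq_toFinset_card']
        exact (Set.ncard_insert_le _ _).trans (by simp))
  · rintro _ ⟨x, hx, rfl⟩
    rw [mem_ball_iff_norm, hT, add_sub_cancel_right]
    calc ‖M (x - V i₀)‖ ≤ l * ‖x - V i₀‖ := hMle _
      _ ≤ l * R := by gcongr; exact hKR x hx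
      _ < ε := hlR
  · refine Set.Subset.antisymm ?_ (Set.singleton_subset_iff.2 ⟨⟨_, hV0, hTV⟩, hP⟩)
    rintro _ ⟨⟨x, hx, rfl⟩, hxS⟩
    have h1 : ⟪m, M (x - V i₀)⟫ = 0 := by
      have h2 := AffineSubspace.vsub_mem_direction hxS hP
      rw [hT, vsub_eq_sub, add_sub_cancel_right] at h2
      exact Submodule.inner_left_of_mem_orthogonal h2 hmS
    rw [hM0, hb0, inner_smul_left, hfpr] at h1
    have h3 : f (pr x) = f (pr (V i₀)) := by
      simpa [hl.ne', hpos.ne', hq0, sub_eq_zero] using h1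
    rw [hfiber x hx (hbd x hx h3), hTV]
    rfl
  · intro a v hv hcard
    obtain ⟨i, j, k, ⟨x, ⟨ti, hxi⟩, hxs⟩, ⟨y, ⟨tj, hyj⟩, hys⟩, ⟨z, ⟨tk, hzk⟩, hzs⟩,
      hij, hik, hjk⟩ := (Set.two_lt_ncard_iff (Set.toFinite _)).1 hcard
    obtain ⟨v, rfl⟩ := M.surjective v
    have hv0 : v ≠ 0 := by rintro rfl; simp at hv
    have hvpos : 0 < ‖v‖ := norm_pos_iff.2 hv0
    have hseg (h : Fin n) : segment ℝ (T (V h)) (T (V (h + 1))) = T '' S h :=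
      (image_segment ℝ T.toAffineMap _ _).symm
    rw [hseg] at hxs hys hzs
    obtain ⟨x, hx, rfl⟩ := hxs
    obtain ⟨y, hy, rfl⟩ := hys
    obtain ⟨z, hz, rfl⟩ := hzs
    have hline {x y : E3} {t u : ℝ} (hx : T x = a + t • M v) (hy : T y = a + u • M v) :
        y - x = ⟪‖v‖⁻¹ • v, y - x⟫ • ‖v‖⁻¹ • v := by
      have h1 : y - x = (u - t) • v := by
        apply M.injective
        rw [map_smul, sub_smul, ← add_sub_add_left_eq_sub (u • M v) _ a, ← hx, ← hy, hT, hT,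
          add_sub_add_right_eq_sub, ← map_sub, sub_sub_sub_cancel_right]
      rw [h1, inner_smul_left, inner_smul_right, real_inner_self_eq_norm_sq, smul_smul]
      congr 1
      simp
      field_simp
    have hκv := hκS (‖v‖⁻¹ • v) ⟨norm_smul_inv_norm (𝕜 := ℝ) hv0, i, j, k, hij, hik, hjk,
      x, hx, y, hy, z, hz, hline hxi hyj, hline hxi hzk⟩
    have hκ' : κ * ‖v‖ ^ 2 ≤ ‖v‖ ^ 2 - ⟪w, v⟫ ^ 2 := by
      rw [inner_smul_right] at hκv
      calc κ * ‖v‖ ^ 2 ≤ (1 - (‖v‖⁻¹ * ⟪w, v⟫) ^ 2) * ‖v‖ ^ 2 := by gcongr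
        _ = ‖v‖ ^ 2 - ⟪w, v⟫ ^ 2 := by field_simp
    refine harcsin _ (by positivity) ?_
    rw [div_lt_iff₀ (norm_pos_iff.2 hv)]
    refine pow_lt_pow_iff_left₀ (abs_nonneg _) (by positivity) two_ne_zero |>.1 ?_
    rw [sq_abs, mul_pow, hM2, hMnorm]
    have hwv : ⟪w, v⟫ ^ 2 ≤ ‖v‖ ^ 2 := by nlinarith [mul_pos hκ (pow_pos hvpos 2)]
    calc (l * s * ⟪w, v⟫) ^ 2 = l ^ 2 * (s ^ 2 * ⟪w, v⟫ ^ 2) := by ring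
      _ ≤ l ^ 2 * (s ^ 2 * ‖v‖ ^ 2) := by gcongr
      _ < l ^ 2 * (η ^ 2 * κ * ‖v‖ ^ 2) := by gcongr
      _ = l ^ 2 * η ^ 2 * (κ * ‖v‖ ^ 2) := by ring
      _ ≤ l ^ 2 * η ^ 2 * (‖v‖ ^ 2 - (1 - s ^ 2) * ⟪w, v⟫ ^ 2) := by
        gcongr
        nlinarith [mul_nonneg (sq_nonneg s) (sq_nonneg ⟪w, v⟫)]
      _ = η ^ 2 * (l ^ 2 * (‖v‖ ^ 2 - (1 - s ^ 2) * ⟪w, v⟫ ^ 2)) := by ring
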